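/- arXiv:math/0502082 — 2 statements merged into one kernel-verified Lean document; each statement's English description precedes it below -/
import Mathlib

section
/- Let a, b ≥ 0, let A be a setoid on Fin a and B a setoid on Fin b. The number of pairs (C, S), where C is a setoid on Fin (a+b) and S is a subset of the set of equivalence classes of C such that C_S = A and C_{S^c} = B, equals the binomial coefficient C(a+b, a). Here, for a set S of classes of C whose union T has cardinality t, C_S denotes the setoid on Fin t obtained by restricting C to T and transporting it along the unique order isomorphism Fin t ≃ T, and S^c is the complementary set of classes. -/
open scoped Classical

noncomputable section

/-- The union `T ⊆ Fin k` of the set `S` of equivalence classes of `C`, as a `Finset`. -/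
def classT {k : ℕ} (C : Setoid (Fin k)) (S : Set (Quotient C)) : Finset (Fin k) :=
  Finset.univ.filter fun x => (Quotient.mk C x : Quotient C) ∈ S

/-- The standardization `C_S`: the restriction of `C` to the union `T` of the classes in `S`,
transported along the unique order isomorphism `Fin T.card ≃ T`. -/
def stand {k : ℕ} (C : Setoid (Fin k)) (S : Set (Quotient C)) :
    Setoid (Fin (classT C S).card) :=
  Setoid.comap (fun j => (((classT C S).orderIsoOfFin rfl) j : Fin k)) C

end

theorem mem_classT {k : ℕ} {C : Setoid (Fin k)} {S : Set (Quotient C)} {x : Fin k} :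
    x ∈ classT C S ↔ Quotient.mk C x ∈ S := by
  simp [classT]

theorem classT_compl {k : ℕ} (C : Setoid (Fin k)) (S : Set (Quotient C)) :
    classT C Sᶜ = (classT C S)ᶜ := by
  ext x
  simp [mem_classT]

/-- `C_S = A` holds exactly when the increasing enumeration of the union `T` of the classes in `S`
pulls `C` back to `A`. -/
theorem stand_eq_iff {k n : ℕ} {C : Setoid (Fin k)} {S : Set (Quotient C)} (A : Setoid (Fin n))
    {T : Finset (Fin k)} (hT : classT C S = T) (hn : T.card = n) :
    (∃ h : (classT C S).card = n, stand C S = Setoid.comap (Fin.cast h) A) ↔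
      ∀ i j, C (T.orderEmbOfFin hn i) (T.orderEmbOfFin hn j) ↔ A i j := by
  subst hT hn
  simp [stand, Setoid.ext_iff, Setoid.comap_rel]

/-- The disjoint union of two equivalence relations. -/
def sumSetoid {α β : Type*} (A : Setoid α) (B : Setoid β) : Setoid (α ⊕ β) :=
  Setoid.ker (Sum.map (Quotient.mk A) (Quotient.mk B))

theorem sumSetoid_inl_inl {α β : Type*} {A : Setoid α} {B : Setoid β} {i j : α} :
    sumSetoid A B (.inl i) (.inl j) ↔ A i j :=
  Setoid.ker_def.trans (Sum.inl_injective.eq_iff.trans Quotient.eq)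

theorem sumSetoid_inr_inr {α β : Type*} {A : Setoid α} {B : Setoid β} {i j : β} :
    sumSetoid A B (.inr i) (.inr j) ↔ B i j :=
  Setoid.ker_def.trans (Sum.inr_injective.eq_iff.trans Quotient.eq)

theorem not_sumSetoid_inl_inr {α β : Type*} {A : Setoid α} {B : Setoid β} {i : α} {j : β} :
    ¬ sumSetoid A B (.inl i) (.inr j) :=
  fun h => Sum.inl_ne_inr (Setoid.ker_def.1 h)

theorem not_sumSetoid_inr_inl {α β : Type*} {A : Setoid α} {B : Setoid β} {i : β} {j : α} :
    ¬ sumSetoid A B (.inr i) (.inl j) :=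
  fun h => Sum.inr_ne_inl (Setoid.ker_def.1 h)

/-- If `S` is a set of classes of `C` with union `T`, then `C_S = A` and `C_{Sᶜ} = B` hold exactly
when `C` corresponds to the disjoint union of `A` and `B` under the enumerations of `T` and `Tᶜ`. -/
theorem stand_eq_and_stand_compl_eq_iff {k a b : ℕ} {C : Setoid (Fin k)} {S : Set (Quotient C)}
    (A : Setoid (Fin a)) (B : Setoid (Fin b)) {T : Finset (Fin k)} (hT : classT C S = T)
    (ha : T.card = a) (hb : Tᶜ.card = b) :
    ((∃ h : (classT C S).card = a, stand C S = Setoid.comap (Fin.cast h) A) ∧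
      (∃ h : (classT C Sᶜ).card = b, stand C Sᶜ = Setoid.comap (Fin.cast h) B)) ↔
      C = Setoid.comap (finSumEquivOfFinset ha hb).symm (sumSetoid A B) := by
  have hTc : classT C Sᶜ = Tᶜ := by rw [classT_compl, hT]
  have hmem : ∀ {x y}, C x y → (x ∈ T ↔ y ∈ T) := by
    intro x y h
    rw [← hT, mem_classT, mem_classT, Quotient.sound h]
  have hl : ∀ i, T.orderEmbOfFin ha i ∈ T := T.orderEmbOfFin_mem ha
  have hr : ∀ j, Tᶜ.orderEmbOfFin hb j ∉ T := fun j =>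
    Finset.mem_compl.1 (Tᶜ.orderEmbOfFin_mem hb j)
  have hlr : ∀ i j, ¬ C (T.orderEmbOfFin ha i) (Tᶜ.orderEmbOfFin hb j) := fun i j h =>
    hr j ((hmem h).1 (hl i))
  have hrl : ∀ i j, ¬ C (Tᶜ.orderEmbOfFin hb j) (T.orderEmbOfFin ha i) := fun i j h =>
    hlr i j (C.symm h)
  rw [stand_eq_iff A hT ha, stand_eq_iff B hTc hb, Setoid.ext_iff,
    (finSumEquivOfFinset ha hb).symm.forall_congr_left]
  simp only [(finSumEquivOfFinset ha hb).symm.forall_congr_left, Equiv.symm_symm,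
    Setoid.comap_rel, Equiv.symm_apply_apply, Sum.forall, finSumEquivOfFinset_inl,
    finSumEquivOfFinset_inr, sumSetoid_inl_inl, sumSetoid_inr_inr, not_sumSetoid_inl_inr,
    not_sumSetoid_inr_inl, hlr, hrl, iff_self, implies_true, and_true, true_and,
    forall_and]

/-- A subset saturated under `C` is the union of a set of classes of `C`. -/
theorem exists_classT_eq {k : ℕ} {C : Setoid (Fin k)} {T : Finset (Fin k)}
    (h : ∀ x y, C x y → x ∈ T → y ∈ T) : ∃ S, classT C S = T := by
  refine ⟨Quotient.mk C '' T, Finset.ext fun x => ?_⟩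
  rw [mem_classT]
  constructor
  · rintro ⟨y, hy, hyx⟩
    exact h y x (Quotient.exact hyx) hy
  · exact fun hx => ⟨x, hx, rfl⟩

theorem classT_injective {k : ℕ} (C : Setoid (Fin k)) : Function.Injective (classT C) := by
  intro S S' h
  ext q
  induction q using Quotient.ind with
  | _ x => rw [← mem_classT, ← mem_classT, h]

/-- The number of pairs `(C, S)`, where `C` is a set partition of `[a+b]` and `S` is a subset
of the set of equivalence classes of `C` with `C_S = A` and `C_{Sᶜ} = B`, equals `C(a+b, a)`. -/
theorem stmt3 (a b : ℕ) (A : Setoid (Fin a)) (B : Setoid (Fin b)) :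
    Nat.card {p : Σ C : Setoid (Fin (a + b)), Set (Quotient C) //
        (∃ h : (classT p.1 p.2).card = a,
            stand p.1 p.2 = Setoid.comap (Fin.cast h) A) ∧
        (∃ h : (classT p.1 p.2ᶜ).card = b,
            stand p.1 p.2ᶜ = Setoid.comap (Fin.cast h) B)} =
      (a + b).choose a := by
  have hcompl : ∀ {T : Finset (Fin (a + b))}, T.card = a → Tᶜ.card = b := by
    intro T hT
    rw [Finset.card_compl, Fintype.card_fin, hT, Nat.add_sub_cancel_left]
  have hcard : Nat.card {T : Finset (Fin (a + b)) // T.card = a} = (a + b).choose a := by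
    rw [Nat.card_eq_fintype_card, Fintype.card_finset_len, Fintype.card_fin]
  rw [← hcard]
  refine Nat.card_congr (Equiv.ofBijective (fun p => ⟨classT p.1.1 p.1.2, p.2.1.1⟩) ⟨?_, ?_⟩)
  · rintro ⟨⟨C, S⟩, hp⟩ ⟨⟨C', S'⟩, hp'⟩ h
    have hT : classT C S = classT C' S' := congrArg Subtype.val h
    have hC := (stand_eq_and_stand_compl_eq_iff A B hT hp'.1.1 (hcompl hp'.1.1)).1 hp
    have hC' := (stand_eq_and_stand_compl_eq_iff A B rfl hp'.1.1 (hcompl hp'.1.1)).1 hp'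
    obtain rfl : C = C' := hC.trans hC'.symm
    obtain rfl := classT_injective C hT
    rfl
  · rintro ⟨T, hT⟩
    obtain ⟨S, hS⟩ : ∃ S, classT (Setoid.comap (finSumEquivOfFinset hT (hcompl hT)).symm
        (sumSetoid A B)) S = T := by
      refine exists_classT_eq fun x y hxy hx => ?_
      obtain ⟨u, rfl⟩ := (finSumEquivOfFinset hT (hcompl hT)).surjective x
      obtain ⟨v, rfl⟩ := (finSumEquivOfFinset hT (hcompl hT)).surjective y
      rw [Setoid.comap_rel, Equiv.symm_apply_apply, Equiv.symm_apply_apply] at hxy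
      rcases u with i | i <;> rcases v with j | j
      · simp
      · exact absurd hxy not_sumSetoid_inl_inr
      · exact absurd hxy not_sumSetoid_inr_inl
      · exact absurd hx (Finset.mem_compl.1 (by simp))
    exact ⟨⟨⟨_, S⟩, (stand_eq_and_stand_compl_eq_iff A B hS hT (hcompl hT)).2 rfl⟩,
      Subtype.ext hS⟩
end

section
/- For every n ≥ 1, ∑_{i=1}^{n} G(i) · (n−i)! = n!, where G(k) is the number of permutations of Fin k with no global descent; equivalently, G(1) = 1 and G(n) = n! − ∑_{i=1}^{n−1} G(i)·(n−i)! for n > 1. -/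
/-- A permutation `π` of `Fin k` has a global descent at position `j` (`1 ≤ j ≤ k−1`)
if `π a > π b` whenever `a < j ≤ b`. -/
def HasGlobalDescent {k : ℕ} (π : Equiv.Perm (Fin k)) : Prop :=
  ∃ j : ℕ, 1 ≤ j ∧ j ≤ k - 1 ∧ ∀ a b : Fin k, (a : ℕ) < j → j ≤ (b : ℕ) → π b < π a

/-- `G k`: the number of permutations of `Fin k` with no global descent. -/
noncomputable def G (k : ℕ) : ℕ :=
  Nat.card {π : Equiv.Perm (Fin k) // ¬ HasGlobalDescent π}

/-- `ρ` maps the first `j` elements of `Fin k` to themselves. -/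
def StabilizesInitial {k : ℕ} (j : ℕ) (ρ : Equiv.Perm (Fin k)) : Prop :=
  ∀ a : Fin k, (a : ℕ) < j → (ρ a : ℕ) < j

theorem stabilizesInitial_iff_lt {k j : ℕ} {ρ : Equiv.Perm (Fin k)} :
    StabilizesInitial j ρ ↔ ∀ a b : Fin k, (a : ℕ) < j → j ≤ (b : ℕ) → ρ a < ρ b := by
  constructor
  · intro h a b ha hb
    have hb' : j ≤ (ρ b : ℕ) := by
      by_contra! hlt
      have := Equiv.Perm.perm_symm_on_of_perm_on_finite (f := ρ)
        (p := fun x : Fin k => (x : ℕ) < j) (fun x hx => h x hx) hlt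
      simp at this
      omega
    have := h a ha
    exact Fin.lt_def.2 (by omega)
  · intro h a ha
    by_contra! hge
    have := Equiv.Perm.perm_symm_on_of_perm_on_finite (f := ρ)
      (p := fun x : Fin k => j ≤ (x : ℕ))
      (fun x hx => hge.trans (Fin.lt_def.1 (h a x ha hx)).le) hge
    simp at this
    omega

theorem hasGlobalDescent_iff {k : ℕ} (π : Equiv.Perm (Fin k)) :
    HasGlobalDescent π ↔
      ∃ j : ℕ, 1 ≤ j ∧ j < k ∧ StabilizesInitial j (π.trans Fin.revPerm) := by
  simp only [HasGlobalDescent, stabilizesInitial_iff_lt, Equiv.trans_apply, Fin.revPerm_apply,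
    Fin.rev_lt_rev]
  refine exists_congr fun j => and_congr_right fun hj => and_congr_left fun _ => ?_
  omega

theorem G_eq_card_indecomposable (k : ℕ) :
    G k = Nat.card {ρ : Equiv.Perm (Fin k) //
      ∀ j : ℕ, 1 ≤ j → j < k → ¬ StabilizesInitial j ρ} := by
  rw [G]
  refine Nat.card_congr (Equiv.subtypeEquiv
    ((Equiv.refl (Fin k)).equivCongr Fin.revPerm) fun π => ?_)
  rw [hasGlobalDescent_iff]
  push Not
  rfl

/-- The permutation of `Fin (m + k)` acting by `σ` on the first `m` elements and by `τ` on the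
last `k`. -/
def directSum {m k : ℕ} (σ : Equiv.Perm (Fin m)) (τ : Equiv.Perm (Fin k)) :
    Equiv.Perm (Fin (m + k)) :=
  finSumFinEquiv.permCongr (Equiv.Perm.sumCongr σ τ)

@[simp]
theorem directSum_castAdd {m k : ℕ} (σ : Equiv.Perm (Fin m)) (τ : Equiv.Perm (Fin k))
    (a : Fin m) : directSum σ τ (Fin.castAdd k a) = Fin.castAdd k (σ a) := by
  simp [directSum, Equiv.permCongr_apply]

theorem directSum_injective (m k : ℕ) :
    Function.Injective fun p : Equiv.Perm (Fin m) × Equiv.Perm (Fin k) => directSum p.1 p.2 :=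
  (Equiv.injective _).comp Equiv.Perm.sumCongrHom_injective

theorem stabilizesInitial_directSum {m k j : ℕ} (hj : j ≤ m) (σ : Equiv.Perm (Fin m))
    (τ : Equiv.Perm (Fin k)) :
    StabilizesInitial j (directSum σ τ) ↔ StabilizesInitial j σ := by
  constructor
  · intro h a ha
    simpa using h (Fin.castAdd k a) ha
  · intro h a ha
    obtain ⟨a, rfl⟩ : ∃ b : Fin m, a = Fin.castAdd k b := ⟨⟨a, by omega⟩, rfl⟩
    simpa using h a ha

theorem exists_directSum_eq {m k : ℕ} {ρ : Equiv.Perm (Fin (m + k))}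
    (h : StabilizesInitial m ρ) : ∃ σ τ, directSum σ τ = ρ := by
  obtain ⟨⟨σ, τ⟩, hστ⟩ := Equiv.Perm.mem_sumCongrHom_range_of_perm_mapsTo_inl
    (σ := finSumFinEquiv.symm.permCongr ρ) (by
      rintro _ ⟨a, rfl⟩
      refine ⟨⟨ρ (Fin.castAdd k a), h _ a.2⟩, ?_⟩
      rw [Equiv.permCongr_apply, Equiv.eq_symm_apply]
      simp)
  refine ⟨σ, τ, ?_⟩
  have : Equiv.Perm.sumCongr σ τ = finSumFinEquiv.symm.permCongr ρ := hστ
  rw [directSum, this]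
  ext
  simp [Equiv.permCongr_apply]

theorem card_first_stabilized (m k : ℕ) :
    Nat.card {ρ : Equiv.Perm (Fin (m + k)) //
      StabilizesInitial m ρ ∧ ∀ j : ℕ, 1 ≤ j → j < m → ¬ StabilizesInitial j ρ} =
      G m * k.factorial := by
  have hk : k.factorial = Nat.card (Equiv.Perm (Fin k)) := by
    rw [Nat.card_perm, Nat.card_fin]
  rw [G_eq_card_indecomposable, hk, ← Nat.card_prod]
  symm
  refine Nat.card_congr (Equiv.ofBijective
    (fun p => ⟨directSum p.1.1 p.2,
      (stabilizesInitial_directSum le_rfl _ _).2 fun a _ => (p.1.1 a).2,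
      fun j hj hjm h => p.1.2 j hj hjm ((stabilizesInitial_directSum hjm.le _ _).1 h)⟩) ⟨?_, ?_⟩)
  · rintro ⟨⟨σ, hσ⟩, τ⟩ ⟨⟨σ', hσ'⟩, τ'⟩ h
    have := @directSum_injective m k (σ, τ) (σ', τ') (congrArg Subtype.val h)
    simp_all
  · rintro ⟨ρ, hρ, hmin⟩
    obtain ⟨σ, τ, rfl⟩ := exists_directSum_eq hρ
    exact ⟨⟨⟨σ, fun j hj hjm h =>
      hmin j hj hjm ((stabilizesInitial_directSum hjm.le _ _).2 h)⟩, τ⟩, rfl⟩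

/-- For every `n ≥ 1`, `∑_{i=1}^{n} G(i)·(n−i)! = n!`. -/
theorem stmt8 (n : ℕ) (hn : 1 ≤ n) :
    ∑ i ∈ Finset.Icc 1 n, G i * (n - i).factorial = n.factorial := by
  classical
  have hex (ρ : Equiv.Perm (Fin n)) : ∃ j, 1 ≤ j ∧ StabilizesInitial j ρ :=
    ⟨n, hn, fun a _ => (ρ a).2⟩
  have hcard : n.factorial = (Finset.univ : Finset (Equiv.Perm (Fin n))).card := by
    rw [Finset.card_univ, Fintype.card_perm, Fintype.card_fin]
  rw [hcard, Finset.card_eq_sum_card_fiberwise (f := fun ρ => Nat.find (hex ρ))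
    (t := Finset.Icc 1 n) fun ρ _ => Finset.mem_coe.2 (Finset.mem_Icc.2
      ⟨(Nat.find_spec (hex ρ)).1, Nat.find_min' _ ⟨hn, fun a _ => (ρ a).2⟩⟩)]
  refine Finset.sum_congr rfl fun i hi => ?_
  obtain ⟨hi1, hin⟩ := Finset.mem_Icc.1 hi
  obtain ⟨k, rfl⟩ := Nat.exists_eq_add_of_le hin
  rw [Nat.add_sub_cancel_left, ← card_first_stabilized, Nat.card_eq_fintype_card,
    Fintype.card_subtype]
  congr 1
  ext ρ
  simp only [Finset.mem_filter, Finset.mem_univ, true_and, Nat.find_eq_iff]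
  grind
end
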